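/- arXiv:2102.09731 — 3 statements merged into one kernel-verified Lean document; each statement's English description precedes it below -/
import Mathlib

section
/- Correctness of the unconstrained Riccati backward step: Suppose vectors Δx ∈ ℝ^{n_x}, Δu ∈ ℝ^{n_u}, Δx⁺, Δλ, Δλ⁺ ∈ ℝ^{n_x} satisfy (i) A Δx + B Δu − Δx⁺ + w = 0; (ii) Q_xx Δx + Q_xu Δu + Aᵀ Δλ⁺ − Δλ + l_x = 0; (iii) Q_xuᵀ Δx + Q_uu Δu + Bᵀ Δλ⁺ + l_u = 0; and (iv) Δλ⁺ = P⁺ Δx⁺ − s⁺. Then Δu = K Δx + k and Δλ = P Δx − s. Moreover, the matrix P is symmetric. -/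
noncomputable section

open Matrix

/-- **Correctness of the unconstrained Riccati backward step**: if `(Δx, Δu, Δx⁺, Δl, Δl⁺)`
satisfy the stage KKT equations and `Δl⁺ = P⁺ Δx⁺ - s⁺`, then `Δu = K Δx + k` and
`Δl = P Δx - s`, and `P` is symmetric. -/
theorem riccati_unconstrained_step {nx nu : ℕ} (hnx : 0 < nx) (hnu : 0 < nu)
    (Qxx : Matrix (Fin nx) (Fin nx) ℝ) (hQxx : Qxx.IsSymm)
    (Qxu : Matrix (Fin nx) (Fin nu) ℝ)
    (Quu : Matrix (Fin nu) (Fin nu) ℝ) (hQuu : Quu.IsSymm)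
    (A : Matrix (Fin nx) (Fin nx) ℝ) (B : Matrix (Fin nx) (Fin nu) ℝ)
    (Pp : Matrix (Fin nx) (Fin nx) ℝ) (hPp : Pp.IsSymm)
    (sp lx w : Fin nx → ℝ) (lu : Fin nu → ℝ)
    (hG : IsUnit (Quu + Bᵀ * Pp * B))
    (Δx Δxp Δl Δlp : Fin nx → ℝ) (Δu : Fin nu → ℝ)
    (h1 : A.mulVec Δx + B.mulVec Δu - Δxp + w = 0)
    (h2 : Qxx.mulVec Δx + Qxu.mulVec Δu + Aᵀ.mulVec Δlp - Δl + lx = 0)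
    (h3 : Qxuᵀ.mulVec Δx + Quu.mulVec Δu + Bᵀ.mulVec Δlp + lu = 0)
    (h4 : Δlp = Pp.mulVec Δxp - sp) :
    let F := Qxx + Aᵀ * Pp * A
    let H := Qxu + Aᵀ * Pp * B
    let G := Quu + Bᵀ * Pp * B
    let K := -(G⁻¹ * Hᵀ)
    let k := -(G⁻¹.mulVec (Bᵀ.mulVec (Pp.mulVec w) - Bᵀ.mulVec sp + lu))
    let P := F - Kᵀ * G * K
    let s := Aᵀ.mulVec (sp - Pp.mulVec w) - lx - H.mulVec k
    Δu = K.mulVec Δx + k ∧ Δl = P.mulVec Δx - s ∧ P.IsSymm := by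
  intro F H G K k P s
  have hdet : IsUnit G.det := (Matrix.isUnit_iff_isUnit_det _).1 hG
  have hGs : Gᵀ = G := by
    simp only [G, transpose_add, transpose_mul, transpose_transpose, hQuu.eq, hPp.eq,
      Matrix.mul_assoc]
  have hFs : Fᵀ = F := by
    simp only [F, transpose_add, transpose_mul, transpose_transpose, hQxx.eq, hPp.eq,
      Matrix.mul_assoc]
  have hHt : Hᵀ = Qxuᵀ + Bᵀ * Pp * A := by
    simp only [H, transpose_add, transpose_mul, transpose_transpose, hPp.eq,
      Matrix.mul_assoc]
  have hKG : Kᵀ * G = -H := by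
    simp only [K, transpose_neg, transpose_mul, transpose_transpose, transpose_nonsing_inv,
      hGs, Matrix.neg_mul, Matrix.mul_assoc, Matrix.nonsing_inv_mul _ hdet, Matrix.mul_one]
  have hxp : Δxp = A.mulVec Δx + B.mulVec Δu + w := by
    have h := h1
    rw [← sub_eq_zero, ← neg_eq_zero, ← h]
    abel
  have hGu : G.mulVec Δu
      = -(Hᵀ.mulVec Δx + (Bᵀ.mulVec (Pp.mulVec w) - Bᵀ.mulVec sp + lu)) := by
    rw [← sub_eq_zero, ← h3, h4, hxp, hHt]
    simp only [G, add_mulVec, mulVec_add, mulVec_sub, ← mulVec_mulVec]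
    abel
  have hu : Δu = K.mulVec Δx + k := by
    have h : Δu = G⁻¹.mulVec (G.mulVec Δu) := by
      rw [mulVec_mulVec, Matrix.nonsing_inv_mul _ hdet, one_mulVec]
    rw [h, hGu]
    simp only [K, k, mulVec_neg, neg_mulVec, ← mulVec_mulVec, mulVec_add]
    abel
  refine ⟨hu, ?_, ?_⟩
  · have hl : Δl = F.mulVec Δx + H.mulVec Δu - (Aᵀ.mulVec (sp - Pp.mulVec w) - lx) := by
      rw [← sub_eq_zero, ← neg_eq_zero, ← h2, h4, hxp]
      simp only [F, H, add_mulVec, mulVec_add, mulVec_sub, ← mulVec_mulVec]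
      abel
    rw [hl, hu]
    simp only [P, s, hKG, sub_mulVec, Matrix.neg_mul, neg_mulVec, mulVec_add, ← mulVec_mulVec]
    abel
  · change Pᵀ = P
    simp only [P, transpose_sub, transpose_mul, transpose_transpose, hFs, hGs, Matrix.mul_assoc]
end
end

section
/- Correctness of the equality-constrained Riccati backward step: Suppose vectors Δx ∈ ℝ^{n_x}, Δu ∈ ℝ^{n_u}, Δν ∈ ℝ^{n_c}, Δx⁺, Δλ, Δλ⁺ ∈ ℝ^{n_x} satisfy (i) A Δx + B Δu − Δx⁺ + w = 0; (ii) Q_xx Δx + Q_xu Δu + Aᵀ Δλ⁺ − Δλ + Cᵀ Δν + l_x = 0; (iii) Q_xuᵀ Δx + Q_uu Δu + Bᵀ Δλ⁺ + Dᵀ Δν + l_u = 0; (iv) C Δx + D Δu + φ̄ = 0; and (v) Δλ⁺ = P⁺ Δx⁺ − s⁺. Then Δu = K Δx + k, Δν = M Δx + m, and Δλ = P Δx − s. Moreover, the matrix P is symmetric. -/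
noncomputable section

open Matrix

/-- **Correctness of the equality-constrained Riccati backward step**: if
`(Δx, Δu, Δν, Δx⁺, Δλ, Δλ⁺)` satisfy the constrained stage KKT equations and
`Δλ⁺ = P⁺ Δx⁺ - s⁺`, then `Δu = K Δx + k`, `Δν = M Δx + m`, `Δλ = P Δx - s`,
and `P` is symmetric. -/
theorem riccati_constrained_step {nx nu nc : ℕ} (hnx : 0 < nx) (hnu : 0 < nu) (hnc : 0 < nc)
    (Qxx : Matrix (Fin nx) (Fin nx) ℝ) (hQxx : Qxx.IsSymm)
    (Qxu : Matrix (Fin nx) (Fin nu) ℝ)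
    (Quu : Matrix (Fin nu) (Fin nu) ℝ) (hQuu : Quu.IsSymm)
    (A : Matrix (Fin nx) (Fin nx) ℝ) (B : Matrix (Fin nx) (Fin nu) ℝ)
    (Pp : Matrix (Fin nx) (Fin nx) ℝ) (hPp : Pp.IsSymm)
    (C : Matrix (Fin nc) (Fin nx) ℝ) (D : Matrix (Fin nc) (Fin nu) ℝ)
    (sp lx w : Fin nx → ℝ) (lu : Fin nu → ℝ) (φb : Fin nc → ℝ)
    (hT : IsUnit (Matrix.fromBlocks (Quu + Bᵀ * Pp * B) Dᵀ D 0))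
    (Δx Δxp Δl Δlp : Fin nx → ℝ) (Δu : Fin nu → ℝ) (Δn : Fin nc → ℝ)
    (h1 : A.mulVec Δx + B.mulVec Δu - Δxp + w = 0)
    (h2 : Qxx.mulVec Δx + Qxu.mulVec Δu + Aᵀ.mulVec Δlp - Δl + Cᵀ.mulVec Δn + lx = 0)
    (h3 : Qxuᵀ.mulVec Δx + Quu.mulVec Δu + Bᵀ.mulVec Δlp + Dᵀ.mulVec Δn + lu = 0)
    (h4 : C.mulVec Δx + D.mulVec Δu + φb = 0)
    (h5 : Δlp = Pp.mulVec Δxp - sp) :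
    let F := Qxx + Aᵀ * Pp * A
    let H := Qxu + Aᵀ * Pp * B
    let G := Quu + Bᵀ * Pp * B
    let T := Matrix.fromBlocks G Dᵀ D (0 : Matrix (Fin nc) (Fin nc) ℝ)
    let KM := -(T⁻¹ * Matrix.fromRows Hᵀ C)
    let K := KM.submatrix Sum.inl id
    let M := KM.submatrix Sum.inr id
    let km := -(T⁻¹.mulVec (Sum.elim (Bᵀ.mulVec (Pp.mulVec w) - Bᵀ.mulVec sp + lu) φb))
    let kv := fun i => km (Sum.inl i)
    let m := fun i => km (Sum.inr i)
    let P := F - KMᵀ * T * KM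
    let s := Aᵀ.mulVec (sp - Pp.mulVec w) - lx - H.mulVec kv - Cᵀ.mulVec m
    Δu = K.mulVec Δx + kv ∧ Δn = M.mulVec Δx + m ∧ Δl = P.mulVec Δx - s ∧ P.IsSymm := by
  intro F H G T KM K M km kv m P s
  have hGs : Gᵀ = G := by
    simp only [G, transpose_add, transpose_mul, transpose_transpose, hQuu.eq, hPp.eq,
      Matrix.mul_assoc]
  have hFs : Fᵀ = F := by
    simp only [F, transpose_add, transpose_mul, transpose_transpose, hQxx.eq, hPp.eq,
      Matrix.mul_assoc]
  have hHt : Hᵀ = Qxuᵀ + Bᵀ * Pp * A := by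
    simp only [H, transpose_add, transpose_mul, transpose_transpose, hPp.eq,
      Matrix.mul_assoc]
  have hTs : Tᵀ = T := by
    simp only [T, fromBlocks_transpose, transpose_transpose, hGs, transpose_zero]
  have hTu : IsUnit T.det := (Matrix.isUnit_iff_isUnit_det _).1 hT
  have hxp : Δxp = A.mulVec Δx + B.mulVec Δu + w := by
    have := h1
    rw [← sub_eq_zero, ← neg_eq_zero, ← this]; abel
  -- the stacked system
  have hz : T.mulVec (Sum.elim Δu Δn) =
      -((fromRows Hᵀ C).mulVec Δx +
        Sum.elim (Bᵀ.mulVec (Pp.mulVec w) - Bᵀ.mulVec sp + lu) φb) := by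
    rw [eq_neg_iff_add_eq_zero, fromBlocks_mulVec, fromRows_mulVec, hHt]
    funext i
    rcases i with i | i
    · have := congrFun h3 i
      rw [h5, hxp] at this
      simp only [G, mulVec_add, mulVec_sub, add_mulVec, mulVec_mulVec, Pi.add_apply, Pi.sub_apply,
        Pi.zero_apply, Sum.elim_inl, Matrix.mul_assoc, Sum.elim_comp_inl, Sum.elim_comp_inr]
        at this ⊢
      linarith
    · have := congrFun h4 i
      simp only [zero_mulVec, Pi.add_apply,
        Pi.zero_apply, Sum.elim_inr, Sum.elim_comp_inl, Sum.elim_comp_inr] at this ⊢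
      linarith
  have hz' : Sum.elim Δu Δn = KM.mulVec Δx + km := by
    have h := congrArg (fun v => T⁻¹.mulVec v) hz
    simp only [mulVec_mulVec, Matrix.nonsing_inv_mul T hTu, one_mulVec] at h
    rw [h]
    simp only [KM, km, mulVec_neg, mulVec_add, neg_mulVec, mulVec_mulVec, neg_add]
  have hu : Δu = K.mulVec Δx + kv := by
    funext i
    exact congrFun hz' (Sum.inl i)
  have hn : Δn = M.mulVec Δx + m := by
    funext i
    exact congrFun hz' (Sum.inr i)
  have hTK : T * KM = -fromRows Hᵀ C := by
    simp only [KM, Matrix.mul_neg, Matrix.mul_nonsing_inv_cancel_left T _ hTu]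
  have hKT : KMᵀ * T = -(fromRows Hᵀ C)ᵀ := by
    have h := congrArg transpose hTK
    rwa [transpose_mul, hTs, transpose_neg] at h
  have hKM : KM = fromRows K M := by
    ext i j
    rcases i with i | i <;> rfl
  have hP : P = F + (H * K + Cᵀ * M) := by
    have h : KMᵀ * T * KM = -(H * K + Cᵀ * M) := by
      rw [hKT, hKM, transpose_fromRows, transpose_transpose, Matrix.neg_mul,
        fromCols_mul_fromRows]
    simp only [P]
    rw [h, sub_neg_eq_add]
  refine ⟨hu, hn, ?_, ?_⟩
  · have hl : Δl = F.mulVec Δx + H.mulVec Δu + Cᵀ.mulVec Δn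
        - (Aᵀ.mulVec (sp - Pp.mulVec w) - lx) := by
      rw [h5, hxp] at h2
      funext i
      have := congrFun h2 i
      simp only [F, H, mulVec_add, mulVec_sub, add_mulVec, mulVec_mulVec, Pi.add_apply,
        Pi.sub_apply, Pi.zero_apply, Matrix.mul_assoc] at this ⊢
      linarith
    rw [hl, hP, hu, hn]
    simp only [s, mulVec_add, add_mulVec, mulVec_mulVec]
    abel
  · change (F - KMᵀ * T * KM)ᵀ = F - KMᵀ * T * KM
    simp only [transpose_sub, transpose_mul, transpose_transpose, hFs, hTs, Matrix.mul_assoc]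
end
end

section
/- Correctness of the full Riccati recursion (Algorithm 1): Define the backward recursion P_N := Q_{xx,N}, s_N := −l_{x,N}, and for i = N−1 down to 0: F_i := Q_{xx,i} + A_iᵀ P_{i+1} A_i, H_i := Q_{xu,i} + A_iᵀ P_{i+1} B_i, G_i := Q_{uu,i} + B_iᵀ P_{i+1} B_i; for i ≠ j, assume G_i is invertible and set K_i := −G_i⁻¹ H_iᵀ, k_i := −G_i⁻¹(B_iᵀ P_{i+1} w_i − B_iᵀ s_{i+1} + l_{u,i}), P_i := F_i − K_iᵀ G_i K_i, s_i := A_iᵀ(s_{i+1} − P_{i+1} w_i) − l_{x,i} − H_i k_i; for i = j, let T := [[G_j, Dᵀ],[D, 0]], assume T is invertible, and set [K_j; M] := −T⁻¹ [H_jᵀ; C], [k_j; m] := −T⁻¹ [B_jᵀ P_{j+1} w_j − B_jᵀ s_{j+1} + l_{u,j}; φ̄], P_j := F_j − [K_jᵀ Mᵀ] T [K_j; M], s_j := A_jᵀ(s_{j+1} − P_{j+1} w_j) − l_{x,j} − H_j k_j − Cᵀ m. Given any Δx_0 ∈ ℝ^{n_x}, define the forward recursion Δu_i := K_i Δx_i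 + k_i, Δx_{i+1} := A_i Δx_i + B_i Δu_i + w_i for i = 0,…,N−1, Δν := M Δx_j + m, and Δλ_i := P_i Δx_i − s_i for i = 0,…,N. Then these vectors satisfy the entire Newton (KKT) linear system: for every i ∈ {0,…,N−1} with i ≠ j: Q_{xx,i} Δx_i + Q_{xu,i} Δu_i + A_iᵀ Δλ_{i+1} − Δλ_i + l_{x,i} = 0 and Q_{xu,i}ᵀ Δx_i + Q_{uu,i} Δu_i + B_iᵀ Δλ_{i+1} + l_{u,i} = 0; at i = j: Q_{xx,j} Δx_j + Q_{xu,j} Δu_j + A_jᵀ Δλ_{j+1} − Δλ_j + Cᵀ Δν + l_{x,j} = 0, Q_{xu,j}ᵀ Δx_j + Q_{uu,j} Δu_j + B_jᵀ Δλ_{j+1} + Dᵀ Δν + l_{u,j} = 0, and C Δx_j + D Δu_j + φ̄ = 0; and at the terminal stage: Q_{xx,N} Δx_N − Δλ_N + l_{x,N} = 0. -/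
noncomputable section

open Matrix

lemma kkt_step {a b c : ℕ} (A Qxx P P' : Matrix (Fin a) (Fin a) ℝ) (B Qxu : Matrix (Fin a) (Fin b) ℝ)
    (Quu : Matrix (Fin b) (Fin b) ℝ) (C M : Matrix (Fin c) (Fin a) ℝ) (D : Matrix (Fin c) (Fin b) ℝ)
    (K : Matrix (Fin b) (Fin a) ℝ) (k lu u : Fin b → ℝ) (w lx s s' x x' l l' : Fin a → ℝ)
    (φ m n : Fin c → ℝ) (hP' : P'ᵀ = P')
    (h1 : (Quu + Bᵀ * P' * B) * K + Dᵀ * M = -(Qxu + Aᵀ * P' * B)ᵀ)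
    (h2 : D * K = -C)
    (h3 : (Quu + Bᵀ * P' * B) *ᵥ k + Dᵀ *ᵥ m = -(Bᵀ *ᵥ (P' *ᵥ w) - Bᵀ *ᵥ s' + lu))
    (h4 : D *ᵥ k = -φ)
    (hP : P = Qxx + Aᵀ * P' * A + (Qxu + Aᵀ * P' * B) * K + Cᵀ * M)
    (hs : s = Aᵀ *ᵥ (s' - P' *ᵥ w) - lx - (Qxu + Aᵀ * P' * B) *ᵥ k - Cᵀ *ᵥ m)
    (hu : u = K *ᵥ x + k) (hx : x' = A *ᵥ x + B *ᵥ u + w) (hn : n = M *ᵥ x + m)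
    (hl : l = P *ᵥ x - s) (hl' : l' = P' *ᵥ x' - s') :
    (Qxx *ᵥ x + Qxu *ᵥ u + Aᵀ *ᵥ l' - l + Cᵀ *ᵥ n + lx = 0) ∧
    (Qxuᵀ *ᵥ x + Quu *ᵥ u + Bᵀ *ᵥ l' + Dᵀ *ᵥ n + lu = 0) ∧
    (C *ᵥ x + D *ᵥ u + φ = 0) := by
  have g1 := congrArg (· *ᵥ x) h1
  have g2 := congrArg (· *ᵥ x) h2
  subst hl hl' hn hx hu hs hP
  simp only [transpose_add, transpose_mul, transpose_transpose, hP', Matrix.add_mul, mulVec_add,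
    add_mulVec, mulVec_sub, sub_mulVec, neg_mulVec, ← mulVec_mulVec] at *
  refine ⟨?_, ?_, ?_⟩
  · ring
  · linear_combination g1 + h3
  · linear_combination g2 + h4

/-- **Correctness of the full Riccati recursion (Algorithm 1)**: given matrices/vectors
`P, s, K, k, M, m` satisfying the defining equations of the backward Riccati recursion
(standard step at every stage `i ≠ j`, equality-constrained step at the distinguished
stage `j`), and vectors `Δx, Δu, Δν, Δλ` produced by the forward recursion from an
arbitrary `Δx_0`, the whole Newton (KKT) linear system is satisfied. -/
theorem riccati_full_recursion {nx nu nc : ℕ} (hnx : 0 < nx) (hnu : 0 < nu) (hnc : 0 < nc)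
    (N : ℕ) (hN : 1 ≤ N) (j : ℕ) (hj : j < N)
    (A : ℕ → Matrix (Fin nx) (Fin nx) ℝ) (B : ℕ → Matrix (Fin nx) (Fin nu) ℝ)
    (Qxx : ℕ → Matrix (Fin nx) (Fin nx) ℝ) (hQxx : ∀ i ≤ N, (Qxx i).IsSymm)
    (Qxu : ℕ → Matrix (Fin nx) (Fin nu) ℝ)
    (Quu : ℕ → Matrix (Fin nu) (Fin nu) ℝ) (hQuu : ∀ i < N, (Quu i).IsSymm)
    (w lx : ℕ → Fin nx → ℝ) (lu : ℕ → Fin nu → ℝ)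
    (C : Matrix (Fin nc) (Fin nx) ℝ) (D : Matrix (Fin nc) (Fin nu) ℝ) (φb : Fin nc → ℝ)
    -- the backward recursion
    (P : ℕ → Matrix (Fin nx) (Fin nx) ℝ) (s : ℕ → Fin nx → ℝ)
    (K : ℕ → Matrix (Fin nu) (Fin nx) ℝ) (k : ℕ → Fin nu → ℝ)
    (M : Matrix (Fin nc) (Fin nx) ℝ) (m : Fin nc → ℝ)
    (hPN : P N = Qxx N) (hsN : s N = -(lx N))
    (hstep : ∀ i < N, i ≠ j →
      let F := Qxx i + (A i)ᵀ * P (i + 1) * A i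
      let H := Qxu i + (A i)ᵀ * P (i + 1) * B i
      let G := Quu i + (B i)ᵀ * P (i + 1) * B i
      IsUnit G ∧
      K i = -(G⁻¹ * Hᵀ) ∧
      k i = -(G⁻¹.mulVec ((B i)ᵀ.mulVec ((P (i + 1)).mulVec (w i))
          - (B i)ᵀ.mulVec (s (i + 1)) + lu i)) ∧
      P i = F - (K i)ᵀ * G * K i ∧
      s i = (A i)ᵀ.mulVec (s (i + 1) - (P (i + 1)).mulVec (w i)) - lx i - H.mulVec (k i))
    (hstepj :
      let F := Qxx j + (A j)ᵀ * P (j + 1) * A j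
      let H := Qxu j + (A j)ᵀ * P (j + 1) * B j
      let G := Quu j + (B j)ᵀ * P (j + 1) * B j
      let T := Matrix.fromBlocks G Dᵀ D (0 : Matrix (Fin nc) (Fin nc) ℝ)
      IsUnit T ∧
      Matrix.fromRows (K j) M = -(T⁻¹ * Matrix.fromRows Hᵀ C) ∧
      Sum.elim (k j) m = -(T⁻¹.mulVec (Sum.elim
          ((B j)ᵀ.mulVec ((P (j + 1)).mulVec (w j)) - (B j)ᵀ.mulVec (s (j + 1)) + lu j) φb)) ∧
      P j = F - (Matrix.fromRows (K j) M)ᵀ * T * Matrix.fromRows (K j) M ∧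
      s j = (A j)ᵀ.mulVec (s (j + 1) - (P (j + 1)).mulVec (w j)) - lx j - H.mulVec (k j)
          - Cᵀ.mulVec m)
    -- the forward recursion
    (Δx : ℕ → Fin nx → ℝ) (Δu : ℕ → Fin nu → ℝ) (Δn : Fin nc → ℝ) (Δl : ℕ → Fin nx → ℝ)
    (hΔu : ∀ i < N, Δu i = (K i).mulVec (Δx i) + k i)
    (hΔx : ∀ i < N, Δx (i + 1) = (A i).mulVec (Δx i) + (B i).mulVec (Δu i) + w i)
    (hΔn : Δn = M.mulVec (Δx j) + m)
    (hΔl : ∀ i ≤ N, Δl i = (P i).mulVec (Δx i) - s i) :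
    -- the Newton (KKT) linear system holds
    (∀ i < N, i ≠ j →
      (Qxx i).mulVec (Δx i) + (Qxu i).mulVec (Δu i) + (A i)ᵀ.mulVec (Δl (i + 1))
          - Δl i + lx i = 0 ∧
      (Qxu i)ᵀ.mulVec (Δx i) + (Quu i).mulVec (Δu i) + (B i)ᵀ.mulVec (Δl (i + 1))
          + lu i = 0) ∧
    ((Qxx j).mulVec (Δx j) + (Qxu j).mulVec (Δu j) + (A j)ᵀ.mulVec (Δl (j + 1)) - Δl j
        + Cᵀ.mulVec Δn + lx j = 0) ∧
    ((Qxu j)ᵀ.mulVec (Δx j) + (Quu j).mulVec (Δu j) + (B j)ᵀ.mulVec (Δl (j + 1))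
        + Dᵀ.mulVec Δn + lu j = 0) ∧
    (C.mulVec (Δx j) + D.mulVec (Δu j) + φb = 0) ∧
    ((Qxx N).mulVec (Δx N) - Δl N + lx N = 0) := by
  have hsymm : ∀ d ≤ N, (P (N - d))ᵀ = P (N - d) := by
    intro d
    induction d with
    | zero => intro _; simpa [hPN] using (hQxx N le_rfl).eq
    | succ d ih =>
      intro hd
      have ih := ih (by omega)
      obtain ⟨i, hi⟩ : ∃ i, i = N - (d + 1) := ⟨_, rfl⟩
      rw [show N - d = i + 1 by omega] at ih
      rw [← hi]
      have hiN : i < N := by omega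
      have hx := (hQxx i hiN.le).eq
      have hu := (hQuu i hiN).eq
      by_cases hij : i = j
      · subst hij
        obtain ⟨-, -, -, h, -⟩ := hstepj
        rw [h]
        simp [transpose_mul, ih, hx, hu, Matrix.mul_assoc, fromBlocks_transpose]
      · obtain ⟨-, -, -, h, -⟩ := hstep i hiN hij
        rw [h]
        simp [transpose_mul, ih, hx, hu, Matrix.mul_assoc]
  have hS : ∀ i ≤ N, (P i)ᵀ = P i := fun i hi => by
    have := hsymm (N - i) (by omega)
    rwa [show N - (N - i) = i by omega] at this
  refine ⟨?_, ?_⟩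
  · intro i hi hij
    obtain ⟨hG, hK, hk, hP, hs⟩ := hstep i hi hij
    have hGd := (Matrix.isUnit_iff_isUnit_det _).1 hG
    have h1 : (Quu i + (B i)ᵀ * P (i + 1) * B i) * K i
        = -(Qxu i + (A i)ᵀ * P (i + 1) * B i)ᵀ := by
      rw [hK, Matrix.mul_neg, Matrix.mul_nonsing_inv_cancel_left _ _ hGd]
    have hGs : (Quu i + (B i)ᵀ * P (i + 1) * B i)ᵀ = Quu i + (B i)ᵀ * P (i + 1) * B i := by
      simp [transpose_mul, hS (i + 1) hi, (hQuu i hi).eq, Matrix.mul_assoc]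
    have h1' : (K i)ᵀ * (Quu i + (B i)ᵀ * P (i + 1) * B i)
        = -(Qxu i + (A i)ᵀ * P (i + 1) * B i) := by
      have := congrArg transpose h1
      rwa [transpose_mul, hGs, transpose_neg, transpose_transpose] at this
    have h3 := congrArg ((Quu i + (B i)ᵀ * P (i + 1) * B i) *ᵥ ·) hk
    simp only [mulVec_neg, mulVec_mulVec, Matrix.mul_nonsing_inv _ hGd, one_mulVec] at h3
    have key := kkt_step (c := 1) (A i) (Qxx i) (P i) (P (i + 1)) (B i) (Qxu i) (Quu i) 0 0 0 (K i)
      (k i) (lu i) (Δu i) (w i) (lx i) (s i) (s (i + 1)) (Δx i) (Δx (i + 1)) (Δl i) (Δl (i + 1))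
      0 0 0 (hS _ hi) (by simpa using h1) (by simp) (by simpa [mulVec_mulVec] using h3) (by simp)
      (by rw [hP, h1', Matrix.neg_mul, sub_neg_eq_add]; simp) (by simpa using hs) (hΔu i hi) (hΔx i hi) (by simp)
      (hΔl i hi.le) (hΔl (i + 1) hi)
    simpa using key.imp_right And.left
  · obtain ⟨hT, hK, hk, hP, hs⟩ := hstepj
    have hTd := (Matrix.isUnit_iff_isUnit_det _).1 hT
    have hTs : (fromBlocks (Quu j + (B j)ᵀ * P (j + 1) * B j) Dᵀ D
        (0 : Matrix (Fin nc) (Fin nc) ℝ))ᵀ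
        = fromBlocks (Quu j + (B j)ᵀ * P (j + 1) * B j) Dᵀ D 0 := by
      simp [fromBlocks_transpose, transpose_mul, hS (j + 1) hj, (hQuu j hj).eq, Matrix.mul_assoc]
    have h1 : fromBlocks (Quu j + (B j)ᵀ * P (j + 1) * B j) Dᵀ D 0 * fromRows (K j) M
        = -fromRows (Qxu j + (A j)ᵀ * P (j + 1) * B j)ᵀ C := by
      rw [hK, Matrix.mul_neg, Matrix.mul_nonsing_inv_cancel_left _ _ hTd]
    have h1' : (fromRows (K j) M)ᵀ * fromBlocks (Quu j + (B j)ᵀ * P (j + 1) * B j) Dᵀ D 0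
        = -(fromRows (Qxu j + (A j)ᵀ * P (j + 1) * B j)ᵀ C)ᵀ := by
      have := congrArg transpose h1
      rwa [transpose_mul, hTs, transpose_neg] at this
    have h3 := congrArg (fromBlocks (Quu j + (B j)ᵀ * P (j + 1) * B j) Dᵀ D 0 *ᵥ ·) hk
    simp only [mulVec_neg] at h3
    rw [mulVec_mulVec, Matrix.mul_nonsing_inv _ hTd, one_mulVec, fromBlocks_mulVec] at h3
    rw [fromBlocks_mul_fromRows, fromRows_neg] at h1
    obtain ⟨e1, e2⟩ := fromRows_inj h1
    have e3 := congrArg (· ∘ Sum.inl) h3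
    have e4 := congrArg (· ∘ Sum.inr) h3
    have key := kkt_step (A j) (Qxx j) (P j) (P (j + 1)) (B j) (Qxu j) (Quu j) C M D (K j)
      (k j) (lu j) (Δu j) (w j) (lx j) (s j) (s (j + 1)) (Δx j) (Δx (j + 1)) (Δl j) (Δl (j + 1))
      φb m Δn (hS _ hj) e1 (by simpa using e2)
      (by funext t; simpa using congrFun e3 t) (by funext t; simpa using congrFun e4 t)
      (by
        rw [hP, h1', transpose_fromRows, transpose_transpose, Matrix.neg_mul,
          fromCols_mul_fromRows, sub_neg_eq_add, add_assoc _ _ (Cᵀ * M)])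
      hs (hΔu j hj) (hΔx j hj) hΔn (hΔl j hj.le) (hΔl (j + 1) hj)
    refine ⟨key.1, key.2.1, key.2.2, ?_⟩
    rw [hΔl N le_rfl, hPN, hsN]
    ring
end
end
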